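/- arXiv:1403.1772 — 2 statements merged into one kernel-verified Lean document; each statement's English description precedes it below -/
import Mathlib

section
/- Let A be a unital C*-algebra, φ a state on A, and (x_i)_{i≥1} a sequence of selfadjoint elements of A such that for every n ≥ 1 the joint distribution of (x₁,…,x_n) with respect to φ is invariant under the linear coaction of 𝓑_s(n). Then for every m ≥ 1, all positive integers k₁,…,k_m, and all indices i₁,…,i_m ≥ 1 with consecutive entries distinct (i₁ ≠ i₂, i₂ ≠ i₃, …, i_{m−1} ≠ i_m): φ(x_{i₁}^{k₁}·x_{i₂}^{k₂}⋯x_{i_m}^{k_m}) = φ(x_1^{k₁}·x_2^{k₂}⋯x_m^{k_m}). -/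
open scoped ComplexOrder

universe u

/-- The family `(u_{ij}, P)` satisfies the defining relations of the boolean permutation
quantum semigroup `𝓑_s(n)`. -/
def BsRel {C : Type u} [Ring C] [StarRing C] {n : ℕ} (u : Fin n → Fin n → C) (P : C) : Prop :=
  (∀ i j, star (u i j) = u i j) ∧
  (∀ i j, u i j * u i j = u i j) ∧
  (∀ i k l, k ≠ l → u i k * u i l = 0) ∧
  (∀ i k l, k ≠ l → u k i * u l i = 0) ∧
  star P = P ∧ P * P = P ∧
  (∀ i, (∑ k, u k i) * P = P)

/-- Invariance of the joint distribution of `(x₁,…,x_n)` with respect to `φ` under the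
linear coaction of `𝓑_s(n)`. -/
def BsLinInvariant {A : Type*} [Ring A] [Algebra ℂ A] {n : ℕ}
    (φ : A →ₗ[ℂ] ℂ) (x : Fin n → A) : Prop :=
  ∀ (C : Type u) [NormedRing C] [StarRing C] [CStarRing C] [NormedAlgebra ℂ C]
    [CompleteSpace C] (u : Fin n → Fin n → C) (P : C), BsRel u P →
    ∀ (m : ℕ) (i : Fin (m + 1) → Fin n),
      φ ((List.ofFn fun t => x (i t)).prod) • P =
        ∑ j : Fin (m + 1) → Fin n,
          φ ((List.ofFn fun t => x (j t)).prod) •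
            (P * (List.ofFn fun t => u (j t) (i t)).prod * P)

open InnerProductSpace in
/-- Gram-type vectors. -/
theorem bs_vectors (n : ℕ) (hn : 2 ≤ n) :
    ∃ (ι : Type u) (_ : Fintype ι) (v : EuclideanSpace ℂ ι)
      (w : Fin n → Fin n → EuclideanSpace ℂ ι) (r : ℂ),
      inner ℂ v v = (1 : ℂ) ∧ (∀ k i, inner ℂ v (w k i) = r) ∧ (∀ k i, inner ℂ (w k i) v = r) ∧
      (∀ k i l j, inner ℂ (w k i) (w l j) =
        if k = l then (if i = j then 1 else 0) else (if i = j then 0 else 1 / ((n : ℂ) - 1))) ∧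
      (∀ i, ∑ k, r • w k i = v) := by
  have hn0 : (n : ℝ) ≠ 0 := by positivity
  have hn1 : (n : ℝ) - 1 ≠ 0 := by
    have : (2 : ℝ) ≤ n := by exact_mod_cast hn
    linarith
  have hnp : (0 : ℝ) ≤ n / (n - 1) := by
    have : (2 : ℝ) ≤ n := by exact_mod_cast hn
    exact div_nonneg (by linarith) (by linarith)
  let s : ℝ := Real.sqrt (n / (n - 1))
  let r : ℝ := Real.sqrt (1 / n)
  have hs : s * s = n / (n - 1) := Real.mul_self_sqrt hnp
  have hr : r * r = 1 / n := Real.mul_self_sqrt (by positivity)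
  let a : Fin n → Fin n → ℝ := fun k l => (if k = l then 1 else 0) - 1 / n
  have ha : ∀ k l, ∑ t, a k t * a l t = (if k = l then 1 else 0) - 1 / n := by
    intro k l
    simp only [a, sub_mul, mul_sub, Finset.sum_sub_distrib]
    simp [eq_comm]
    field_simp
    ring
  have ha1 : ∀ l, ∑ k, a k l = 0 := by
    intro l
    simp [a, hn0]
  let f : Fin n → Fin n → Option (Fin n × Fin n) → ℝ := fun k i o =>
    o.elim r (fun p => s * (a k p.1 * a i p.2))
  let g : Option (Fin n × Fin n) → ℝ := fun o => o.elim 1 (fun _ => 0)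
  have key : ∀ (F G : Option (Fin n × Fin n) → ℝ),
      inner ℂ (WithLp.toLp 2 (fun t : ULift.{u} (Option (Fin n × Fin n)) => (F t.down : ℂ)))
        (WithLp.toLp 2 (fun t : ULift.{u} (Option (Fin n × Fin n)) => (G t.down : ℂ)))
        = ((F none * G none + ∑ p, F (some p) * G (some p) : ℝ) : ℂ) := by
    intro F G
    rw [PiLp.inner_apply, ← Equiv.ulift.symm.sum_comp, Fintype.sum_option]
    simp [mul_comm]
  refine ⟨ULift.{u} (Option (Fin n × Fin n)), inferInstance,
    WithLp.toLp 2 (fun t => (g t.down : ℂ)), fun k i => WithLp.toLp 2 (fun t => (f k i t.down : ℂ)),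
    (r : ℂ), ?_, ?_, ?_, ?_, ?_⟩
  · rw [key]; simp [g]
  · intro k i; rw [key]; simp [g, f]
  · intro k i; rw [key]; simp [g, f]
  · intro k i l j
    rw [key]
    have h1 : ∑ p : Fin n × Fin n, f k i (some p) * f l j (some p) =
        s * s * ((∑ t, a k t * a l t) * (∑ t, a i t * a j t)) := by
      rw [Finset.sum_mul_sum, Fintype.sum_prod_type, Finset.mul_sum]
      refine Finset.sum_congr rfl fun p _ => ?_
      rw [Finset.mul_sum]
      refine Finset.sum_congr rfl fun q _ => ?_
      simp only [f, Option.elim]; ring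
    have h2 : f k i none * f l j none = 1 / n := hr
    rw [h1, h2, ha, ha, hs]
    have : (1 / n + n / (n - 1) * (((if k = l then 1 else 0) - 1 / n) *
       ((if i = j then 1 else 0) - 1 / n)) : ℝ) =
       if k = l then (if i = j then 1 else 0) else (if i = j then 0 else 1 / ((n : ℝ) - 1)) := by
      split_ifs <;> field_simp <;> ring
    rw [this]
    split_ifs <;> simp
  · intro i
    ext t
    obtain ⟨t⟩ := t
    simp only [WithLp.ofLp_sum, Finset.sum_apply, PiLp.smul_apply, smul_eq_mul]
    rw [← Finset.mul_sum]
    norm_cast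
    cases t with
    | none => simp only [f, g, Option.elim, Finset.sum_const, Finset.card_univ, Fintype.card_fin,
                nsmul_eq_mul]
              rw [mul_left_comm, hr]; field_simp
    | some p =>
      simp only [f, g, Option.elim]
      rw [← Finset.mul_sum, ← Finset.sum_mul, ha1]; simp

open InnerProductSpace in
theorem bs_pattern {A : Type u} [Ring A] [Algebra ℂ A] (φ : A →ₗ[ℂ] ℂ) {n : ℕ} (hn : 2 ≤ n)
    (x : Fin n → A) (hinv : BsLinInvariant.{u} φ x) (m : ℕ) (i i' : Fin (m + 1) → Fin n)
    (h : ∀ t : Fin m, i t.castSucc = i t.succ ↔ i' t.castSucc = i' t.succ) :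
    φ ((List.ofFn fun t => x (i t)).prod) = φ ((List.ofFn fun t => x (i' t)).prod) := by
  obtain ⟨ι, _, v, w, r, hv, hvw, hwv, hww, hsum⟩ := bs_vectors.{u} n hn
  let H := EuclideanSpace ℂ ι
  let U : Fin n → Fin n → (H →L[ℂ] H) := fun k i => rankOne ℂ (w k i) (w k i)
  let P : H →L[ℂ] H := rankOne ℂ v v
  have mulR : ∀ a b c d : H, (rankOne ℂ a b : H →L[ℂ] H) * rankOne ℂ c d =
      (inner ℂ b c : ℂ) • rankOne ℂ a d := by
    intro a b c d
    ext1 z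
    simp [rankOne_apply, smul_smul, mul_comm]
  have starR : ∀ a : H, star (rankOne ℂ a a : H →L[ℂ] H) = rankOne ℂ a a := by
    intro a
    rw [ContinuousLinearMap.star_eq_adjoint, adjoint_rankOne]
  have hrel : BsRel U P := by
    refine ⟨fun _ _ => starR _, ?_, ?_, ?_, starR _, ?_, ?_⟩
    · intro i j; simp only [U, mulR, hww]; simp
    · intro i k l hkl; simp only [U, mulR, hww]; simp [hkl]
    · intro i k l hkl; simp only [U, mulR, hww]; simp [hkl]
    · simp only [P, mulR, hv, one_smul]
    · intro i
      ext1 z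
      have hz : (inner ℂ v z : ℂ) • (∑ k, r • w k i) = (inner ℂ v z : ℂ) • v := by rw [hsum]
      simpa [U, P, rankOne_apply, hwv, Finset.smul_sum, smul_smul] using hz
  have hP : P ≠ 0 := by
    intro h0
    have h1 : P v = 0 := by rw [h0]; rfl
    have h2 : P v = v := by simp only [P, rankOne_apply, hv, one_smul]
    rw [h2] at h1
    rw [h1] at hv
    simp at hv
  have coef : ∀ (m : ℕ) (i i' j : Fin (m + 1) → Fin n)
      (_ : ∀ t : Fin m, i t.castSucc = i t.succ ↔ i' t.castSucc = i' t.succ),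
      ∃ c : ℂ, (List.ofFn fun t => U (j t) (i t)).prod * P = c • rankOne ℂ (w (j 0) (i 0)) v ∧
        (List.ofFn fun t => U (j t) (i' t)).prod * P = c • rankOne ℂ (w (j 0) (i' 0)) v := by
    intro m
    induction m with
    | zero =>
      intro i i' j _
      refine ⟨r, ?_, ?_⟩ <;> simp [U, P, mulR, hwv]
    | succ m ih =>
      intro i i' j h
      obtain ⟨c, h1, h2⟩ := ih (fun t => i t.succ) (fun t => i' t.succ) (fun t => j t.succ)
        (fun t => by simpa using h t.succ)
      refine ⟨c * inner ℂ (w (j 0) (i 0)) (w (j (Fin.succ 0)) (i (Fin.succ 0))), ?_, ?_⟩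
      · rw [List.ofFn_succ, List.prod_cons, mul_assoc, h1, mul_smul_comm, mulR, smul_smul]
      · rw [List.ofFn_succ, List.prod_cons, mul_assoc, h2, mul_smul_comm, mulR, smul_smul]
        have h0 : i 0 = i (Fin.succ 0) ↔ i' 0 = i' (Fin.succ 0) := h 0
        simp only [hww, h0]
  have e1 := hinv (H →L[ℂ] H) U P hrel m i
  have e2 := hinv (H →L[ℂ] H) U P hrel m i'
  have e3 : φ ((List.ofFn fun t => x (i t)).prod) • P =
      φ ((List.ofFn fun t => x (i' t)).prod) • P := by
    rw [e1, e2]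
    refine Finset.sum_congr rfl fun j _ => ?_
    obtain ⟨c, h1, h2⟩ := coef m i i' j h
    rw [mul_assoc, mul_assoc, h1, h2]
    simp only [P, mul_smul_comm, mulR, hvw]
  exact smul_left_injective ℂ hP e3

theorem bs_list {A : Type u} [Ring A] [Algebra ℂ A] (φ : A →ₗ[ℂ] ℂ) {n : ℕ} (hn : 2 ≤ n)
    (x : Fin n → A) (hinv : BsLinInvariant.{u} φ x) (Z : List (Fin n × Fin n))
    (hZ : Z.IsChain fun p q => (p.1 = q.1 ↔ p.2 = q.2)) :
    φ ((Z.map fun p => x p.1).prod) = φ ((Z.map fun p => x p.2).prod) := by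
  by_cases h0 : Z = []
  · simp [h0]
  obtain ⟨M, hM⟩ : ∃ M, Z.length = M + 1 :=
    Nat.exists_eq_succ_of_ne_zero (by simpa using h0)
  have hget : Z = List.ofFn fun t : Fin (M + 1) => Z[t.val]'(by omega) := by
    apply List.ext_getElem
    · simp [hM]
    · intro t h1 h2; rw [List.getElem_ofFn]
  have := bs_pattern φ hn x hinv M (fun t => (Z[t.val]'(by omega)).1)
    (fun t => (Z[t.val]'(by omega)).2) (fun t => by
      rw [List.isChain_iff_getElem] at hZ
      simpa using hZ t.val (by omega))
  rw [hget, List.map_ofFn, List.map_ofFn]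
  exact this

/-- Let `φ` be a state on a unital C*-algebra `A` and `(x_i)` a sequence of selfadjoint
elements (here `x t` stands for `x_{t+1}`) whose joint distributions are invariant under the
linear coactions of the `𝓑_s(n)`.  Then for positive exponents `k₀,…,k_m` and indices with
consecutive entries distinct,
`φ(x_{i₀}^{k₀}⋯x_{i_m}^{k_m}) = φ(x_1^{k₀}·x_2^{k₁}⋯x_{m+1}^{k_m})`. -/
theorem stmt10 {A : Type u} [NormedRing A] [StarRing A] [CStarRing A] [NormedAlgebra ℂ A]
    [CompleteSpace A]
    (φ : A →ₗ[ℂ] ℂ) (hpos : ∀ a : A, 0 ≤ φ (star a * a)) (hone : φ 1 = 1)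
    (x : ℕ → A) (hsa : ∀ i, star (x i) = x i)
    (hinv : ∀ n : ℕ, BsLinInvariant.{u} φ fun t : Fin n => x t)
    (m : ℕ) (k : Fin (m + 1) → ℕ) (hk : ∀ t, 1 ≤ k t)
    (i : Fin (m + 1) → ℕ) (hne : ∀ t : Fin m, i t.castSucc ≠ i t.succ) :
    φ ((List.ofFn fun t => x (i t) ^ k t).prod) =
      φ ((List.ofFn fun t : Fin (m + 1) => x t ^ k t).prod) := by
  let N := m + 2 + ∑ t, i t
  have hi : ∀ t, i t < N := fun t => by
    have := Finset.single_le_sum (f := i) (fun _ _ => Nat.zero_le _) (Finset.mem_univ t)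
    omega
  have hj : ∀ t : Fin (m + 1), t.val < N := fun t => by omega
  let p : Fin (m + 1) → Fin N × Fin N := fun t => (⟨i t, hi t⟩, ⟨t, hj t⟩)
  have key := bs_list φ (n := N) (by omega) (fun t => x t) (hinv N)
    (List.ofFn fun t => List.replicate (k t) (p t)).flatten (by
      rw [List.isChain_flatten]
      · constructor
        · intro l hl
          obtain ⟨t, rfl⟩ := List.mem_ofFn.1 hl
          exact List.isChain_replicate_of_rel _ (by simp)
        · rw [List.isChain_iff_getElem]
          intro t ht
          simp only [List.length_ofFn] at ht
          intro a ha b hb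
          simp only [List.getElem_ofFn] at ha hb
          have ha' := List.eq_of_mem_replicate (List.mem_of_getLast? ha)
          have hb' := List.eq_of_mem_replicate (List.mem_of_head? hb)
          subst ha' hb'
          have := hne ⟨t, by omega⟩
          simp only [Fin.castSucc_mk, Fin.succ_mk] at this
          simp [p, this]
      · intro h
        obtain ⟨t, ht⟩ := List.mem_ofFn.1 h
        have := hk t
        simp at ht
        omega)
  simpa [List.map_flatten, List.prod_flatten, List.map_ofFn, Function.comp_def, p] using key
end

section
/- Let A be a unital C*-algebra, φ a state on A, and (x_i)_{i≥1} a sequence of selfadjoint elements of A such that for every n ≥ 1 the joint distribution of (x₁,…,x_n) with respect to φ is invariant under the linear coaction of 𝓑_s(n). Let M ≥ 1 and let a, b belong to the (possibly non-unital) subalgebra of A generated by {x₁,…,x_M}. Then for every m ≥ 1, all positive integers k₁,…,k_m, and all index tuples (i₁,…,i_m) and (j₁,…,j_m) with all entries > M and with consecutive entries distinct in each tuple: φ(a·x_{i₁}^{k₁}·x_{i₂}^{k₂}⋯x_{i_m}^{k_m}·b) = φ(a·x_{j₁}^{k₁}·x_{j₂}^{k₂}⋯x_{j_m}^{k_m}·b).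 -/
open scoped ComplexOrder

universe u

open scoped TensorProduct

theorem aux_vec (n : ℕ) (hn : 2 ≤ n) :
    ∃ (e : Fin n → Fin n → Fin n × Fin n → ℝ) (ξ : Fin n × Fin n → ℝ) (s : ℝ),
      (∀ j i, ∑ p, e j i p * e j i p = 1) ∧
      (∀ j j' i, j ≠ j' → ∑ p, e j i p * e j' i p = 0) ∧
      (∀ j i i', i ≠ i' → ∑ p, e j i p * e j i' p = 0) ∧
      (∀ j j' i i', j ≠ j' → i ≠ i' → ∑ p, e j i p * e j' i' p = ((n : ℝ) - 1)⁻¹) ∧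
      (∀ j i, ∑ p, e j i p * ξ p = s) ∧
      (∑ p, ξ p * ξ p = 1) ∧
      (∀ i p, ∑ j, s * e j i p = ξ p) ∧ (s * s = (n : ℝ)⁻¹) := by
  have hn0 : (n : ℝ) ≠ 0 := by positivity
  have hn2 : (2 : ℝ) ≤ n := by exact_mod_cast hn
  have hn1 : (n : ℝ) - 1 ≠ 0 := by linarith
  obtain ⟨c, hc⟩ : ∃ c : ℝ, c * c = n / (n - 1) :=
    ⟨√(n / (n - 1)), Real.mul_self_sqrt (div_nonneg (by linarith) (by linarith))⟩
  obtain ⟨s, hs⟩ : ∃ s : ℝ, s * s = (n : ℝ)⁻¹ :=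
    ⟨√((n : ℝ)⁻¹), Real.mul_self_sqrt (by positivity)⟩
  let g : Fin n → Fin n → ℝ := fun j a => (if j = a then 1 else 0) - (n : ℝ)⁻¹
  have hg1 : ∀ j, ∑ a, g j a = 0 := by
    intro j; simp [g, Finset.sum_sub_distrib, hn0]
  have hg2 : ∀ a, ∑ j, g j a = 0 := by
    intro j; simp [g, Finset.sum_sub_distrib, hn0]
  have hg3 : ∀ j j', ∑ a, g j a * g j' a = (if j = j' then 1 else 0) - (n : ℝ)⁻¹ := by
    intro j j'
    have : ∀ a, g j a * g j' a = (if j = a then g j' a else 0) - (n : ℝ)⁻¹ * g j' a := by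
      intro a; simp only [g]; split_ifs <;> ring
    simp only [this, Finset.sum_sub_distrib, ← Finset.mul_sum, hg1]
    simp [g, eq_comm]
  have key : ∀ j j' i i', ∑ p : Fin n × Fin n,
      (c * (g j p.1 * g i p.2) + s * (n : ℝ)⁻¹) * (c * (g j' p.1 * g i' p.2) + s * (n : ℝ)⁻¹)
      = n / (n - 1) * (((if j = j' then 1 else 0) - (n : ℝ)⁻¹) *
        ((if i = i' then 1 else 0) - (n : ℝ)⁻¹)) + (n : ℝ)⁻¹ := by
    intro j j' i i'
    rw [← hg3, ← hg3, ← hc, Fintype.sum_prod_type]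
    have : ∀ a b, (c * (g j a * g i b) + s * (n : ℝ)⁻¹) * (c * (g j' a * g i' b) + s * (n : ℝ)⁻¹)
       = (c * c * (g j a * g j' a)) * (g i b * g i' b) + (c * s * (n : ℝ)⁻¹ * g j a) * g i b
        + (c * s * (n : ℝ)⁻¹ * g j' a) * g i' b + (n : ℝ)⁻¹ * (n : ℝ)⁻¹ * (n : ℝ)⁻¹ := by
      intro a b
      rw [show (n : ℝ)⁻¹ * (n : ℝ)⁻¹ * (n : ℝ)⁻¹ = (s * s) * (n : ℝ)⁻¹ * (n : ℝ)⁻¹ by rw [hs]]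
      ring
    simp only [this, Finset.sum_add_distrib, ← Finset.mul_sum, ← Finset.sum_mul, hg1]
    simp
    field_simp
  refine ⟨fun j i p => c * (g j p.1 * g i p.2) + s * (n : ℝ)⁻¹, fun _ => (n : ℝ)⁻¹, s,
    ?_, ?_, ?_, ?_, ?_, ?_, ?_, hs⟩
  · intro j i
    rw [key]; simp; field_simp; ring
  · intro j j' i h
    rw [key]; simp [h]; field_simp; ring
  · intro j i i' h
    rw [key]; simp [h]; field_simp; ring
  · intro j j' i i' h h'
    rw [key]; simp [h, h']; field_simp; ring
  · intro j i
    rw [Fintype.sum_prod_type]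
    simp only [← Finset.sum_mul, Finset.sum_add_distrib, ← Finset.mul_sum, hg1]
    simp
    field_simp
  · rw [Fintype.sum_prod_type]
    simp
    field_simp
  · intro i p
    simp only [mul_add, Finset.sum_add_distrib, ← Finset.mul_sum, ← Finset.sum_mul, hg2]
    simp
    rw [mul_inv_cancel₀ hn0, mul_one, hs]

open scoped Matrix.Norms.L2Operator in
theorem aux_rep (n : ℕ) (hn : 2 ≤ n) :
    ∃ (C : Type u) (_ : NormedRing C) (_ : StarRing C) (_ : CStarRing C)
      (_ : NormedAlgebra ℂ C) (_ : CompleteSpace C) (v : Fin n → Fin n → C) (P : C),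
      BsRel v P ∧ P ≠ 0 ∧
      (∀ j j' i i', j ≠ j' → i ≠ i' → v j i * (v j' i' * P) = ((n : ℂ) - 1)⁻¹ • (v j i * P)) ∧
      (∀ j i, P * (v j i * P) = (n : ℂ)⁻¹ • P) := by
  obtain ⟨e, ξ, s, h1, h2, h3, h4, h5, h6, h7, h8⟩ := aux_vec n hn
  let E : Fin n → Fin n → ULift.{u} (Fin n × Fin n) → ℂ := fun j i p => (e j i p.down : ℂ)
  let Ξ : ULift.{u} (Fin n × Fin n) → ℂ := fun p => (ξ p.down : ℂ)
  have tr : ∀ (f g : Fin n × Fin n → ℝ), (fun p : ULift.{u} (Fin n × Fin n) => (f p.down : ℂ)) ⬝ᵥ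
      (fun p => (g p.down : ℂ)) = ((∑ p, f p * g p : ℝ) : ℂ) := by
    intro f g
    rw [dotProduct, ← (Equiv.ulift.{u}).symm.sum_comp]
    simp
  have k1 : ∀ j i, E j i ⬝ᵥ E j i = 1 := by intro j i; simp only [E]; rw [tr, h1]; simp
  have k2 : ∀ j j' i, j ≠ j' → E j i ⬝ᵥ E j' i = 0 := by
    intro j j' i h; simp only [E]; rw [tr, h2 _ _ _ h]; simp
  have k3 : ∀ j i i', i ≠ i' → E j i ⬝ᵥ E j i' = 0 := by
    intro j i i' h; simp only [E]; rw [tr, h3 _ _ _ h]; simp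
  have k4 : ∀ j j' i i', j ≠ j' → i ≠ i' → E j i ⬝ᵥ E j' i' = ((n : ℂ) - 1)⁻¹ := by
    intro j j' i i' h h'; simp only [E]; rw [tr, h4 _ _ _ _ h h']; simp
  have k5 : ∀ j i, E j i ⬝ᵥ Ξ = s := by intro j i; simp only [E, Ξ]; rw [tr, h5]
  have k5' : ∀ j i, Ξ ⬝ᵥ E j i = s := by intro j i; rw [dotProduct_comm, k5]
  have k6 : Ξ ⬝ᵥ Ξ = 1 := by simp only [Ξ]; rw [tr, h6]; simp
  have k8 : (s : ℂ) * s = (n : ℂ)⁻¹ := by rw [← Complex.ofReal_mul, h8]; simp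
  refine ⟨Matrix (ULift.{u} (Fin n × Fin n)) (ULift.{u} (Fin n × Fin n)) ℂ, inferInstance,
    inferInstance, inferInstance, inferInstance, inferInstance,
    fun j i => Matrix.vecMulVec (E j i) (E j i), Matrix.vecMulVec Ξ Ξ,
    ⟨?_, ?_, ?_, ?_, ?_, ?_, ?_⟩, ?_, ?_, ?_⟩
  · intro i j; ext p q
    simp [Matrix.vecMulVec_apply, E, mul_comm]
  · intro i j
    simp [Matrix.vecMulVec_mul_vecMulVec, k1]
  · intro i k l h
    simp [Matrix.vecMulVec_mul_vecMulVec, k3 _ _ _ h]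
  · intro i k l h
    simp [Matrix.vecMulVec_mul_vecMulVec, k2 _ _ _ h]
  · ext p q
    simp [Matrix.vecMulVec_apply, Ξ, mul_comm]
  · simp [Matrix.vecMulVec_mul_vecMulVec, k6]
  · intro i
    rw [Finset.sum_mul]
    simp only [Matrix.vecMulVec_mul_vecMulVec, k5]
    ext p q
    simp only [Matrix.sum_apply, Matrix.vecMulVec_apply, Pi.smul_apply, smul_eq_mul, Ξ, E]
    have := h7 i p.down
    rw [← this]
    push_cast
    rw [Finset.sum_mul]
    refine Finset.sum_congr rfl fun j _ => by ring
  · intro h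
    have : (Matrix.vecMulVec Ξ Ξ).trace = 0 := by rw [h]; simp
    rw [Matrix.trace_vecMulVec, k6] at this
    exact one_ne_zero this
  · intro j j' i i' h h'
    simp only [Matrix.vecMulVec_mul_vecMulVec, Matrix.mul_smul, Matrix.vecMulVec_smul, k5, k4 _ _ _ _ h h']
    ext p q
    simp [Matrix.vecMulVec_apply]; ring
  · intro j i
    simp only [Matrix.vecMulVec_mul_vecMulVec, Matrix.mul_smul, Matrix.vecMulVec_smul, k5, k5']
    ext p q
    simp [Matrix.vecMulVec_apply]; rw [← k8]; ring

theorem aux_pad {C : Type u} [Ring C] [StarRing C] {n : ℕ} (M : ℕ) (v : Fin n → Fin n → C)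
    (P : C) (h : BsRel v P) :
    ∃ w : Fin (M + n) → Fin (M + n) → C, BsRel w P ∧
      (∀ a b, w (Fin.castAdd n a) (Fin.castAdd n b) = if a = b then 1 else 0) ∧
      (∀ a b, w (Fin.castAdd n a) (Fin.natAdd M b) = 0) ∧
      (∀ a b, w (Fin.natAdd M a) (Fin.castAdd n b) = 0) ∧
      (∀ a b, w (Fin.natAdd M a) (Fin.natAdd M b) = v a b) := by
  obtain ⟨h1, h2, h3, h4, h5, h6, h7⟩ := h
  let w : Fin (M + n) → Fin (M + n) → C :=
    Fin.addCases (fun a => Fin.addCases (fun b => if a = b then 1 else 0) (fun _ => 0))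
      (fun a => Fin.addCases (fun _ => 0) (fun b => v a b))
  have w1 : ∀ a b, w (Fin.castAdd n a) (Fin.castAdd n b) = if a = b then 1 else 0 := by
    intro a b; simp [w]
  have w2 : ∀ a b, w (Fin.castAdd n a) (Fin.natAdd M b) = 0 := by
    intro a b; simp [w]
  have w3 : ∀ a b, w (Fin.natAdd M a) (Fin.castAdd n b) = 0 := by
    intro a b; simp [w]
  have w4 : ∀ a b, w (Fin.natAdd M a) (Fin.natAdd M b) = v a b := by
    intro a b; simp [w]
  refine ⟨w, ⟨?_, ?_, ?_, ?_, h5, h6, ?_⟩, w1, w2, w3, w4⟩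
  · intro i j
    induction i using Fin.addCases <;> induction j using Fin.addCases <;>
      simp only [w1, w2, w3, w4, h1, star_zero]
    split_ifs <;> simp
  · intro i j
    induction i using Fin.addCases <;> induction j using Fin.addCases <;>
      simp only [w1, w2, w3, w4, h2, mul_zero]
    split_ifs <;> simp
  · intro i k l hkl
    induction i using Fin.addCases <;> induction k using Fin.addCases <;>
      induction l using Fin.addCases <;> simp [w1, w2, w3, w4]
    · rintro rfl rfl; exact (hkl rfl).elim
    · apply h3; rintro rfl; exact hkl rfl
  · intro i k l hkl
    induction i using Fin.addCases <;> induction k using Fin.addCases <;>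
      induction l using Fin.addCases <;> simp [w1, w2, w3, w4]
    · rintro rfl rfl; exact (hkl rfl).elim
    · apply h4; rintro rfl; exact hkl rfl
  · intro i
    induction i using Fin.addCases <;> simp [Fin.sum_univ_add, w1, w2, w3, w4, h7]

theorem aux_expand {R ι : Type*} [Ring R] [Fintype ι] (m : ℕ) (g : Fin m → ι → R) :
    (List.ofFn fun t => ∑ j, g t j).prod = ∑ J : Fin m → ι, (List.ofFn fun t => g t (J t)).prod := by
  induction m with
  | zero => simp
  | succ m ih =>
    rw [List.ofFn_succ, List.prod_cons, ih, Finset.sum_mul_sum,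
      ← (Fin.consEquiv (fun _ => ι)).sum_comp, Fintype.sum_prod_type]
    simp [List.ofFn_succ]

theorem aux_tmul {A C : Type*} [Ring A] [Algebra ℂ A] [Ring C] [Algebra ℂ C] (m : ℕ)
    (f : Fin m → A) (g : Fin m → C) :
    (List.ofFn fun t => f t ⊗ₜ[ℂ] g t).prod = (List.ofFn f).prod ⊗ₜ[ℂ] (List.ofFn g).prod := by
  induction m with
  | zero => simp [Algebra.TensorProduct.one_def]
  | succ m ih => simp [List.ofFn_succ, ih]

theorem aux_pow {A C : Type*} [Ring A] [Algebra ℂ A] [Ring C] [Algebra ℂ C] {n : ℕ}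
    (y : Fin n → A) (v : Fin n → C) (hv : ∀ j, v j * v j = v j)
    (hv' : ∀ j l, j ≠ l → v j * v l = 0) (k : ℕ) :
    (∑ j, y j ⊗ₜ[ℂ] v j) ^ (k + 1) = ∑ j, (y j ^ (k + 1)) ⊗ₜ[ℂ] v j := by
  induction k with
  | zero => simp
  | succ k ih =>
    rw [pow_succ, ih, Finset.sum_mul_sum]
    refine Finset.sum_congr rfl fun j _ => ?_
    rw [Finset.sum_eq_single j]
    · simp [hv, pow_succ]
    · intro l _ h; simp [hv' _ _ h.symm]
    · simp

theorem aux_chain {A C : Type*} [Ring A] [Algebra ℂ A] [Ring C] [Algebra ℂ C] {n : ℕ}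
    (y : Fin n → A) (v : Fin n → Fin n → C) (P : C) (c : ℂ)
    (hv : ∀ j i, v j i * v j i = v j i)
    (hr : ∀ i k l, k ≠ l → v i k * v i l = 0)
    (hc : ∀ i k l, k ≠ l → v k i * v l i = 0)
    (hP : ∀ j j' i i', j ≠ j' → i ≠ i' → v j i * (v j' i' * P) = c • (v j i * P))
    (m : ℕ) (k : Fin (m + 1) → ℕ) (hk : ∀ t, 1 ≤ k t) :
    ∃ a : Fin n → A, ∀ I : Fin (m + 1) → Fin n, (∀ t : Fin m, I t.castSucc ≠ I t.succ) →
      (List.ofFn fun t => (∑ j, y j ⊗ₜ[ℂ] v j (I t)) ^ k t).prod * (1 ⊗ₜ[ℂ] P) =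
        ∑ j, a j ⊗ₜ[ℂ] (v j (I 0) * P) := by
  have pw : ∀ i k, 1 ≤ k → (∑ j, y j ⊗ₜ[ℂ] v j i) ^ k = ∑ j, (y j ^ k) ⊗ₜ[ℂ] v j i := by
    intro i k hk
    obtain ⟨k, rfl⟩ := Nat.exists_eq_add_of_le' hk
    exact aux_pow y (fun j => v j i) (fun j => hv j i) (fun j l h => hc i j l h) k
  induction m with
  | zero =>
    refine ⟨fun j => y j ^ k 0, fun I _ => ?_⟩
    simp [pw _ _ (hk 0), Finset.sum_mul]
  | succ m ih =>
    obtain ⟨a, ha⟩ := ih (fun t => k t.succ) (fun t => hk _)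
    refine ⟨fun j => ∑ l, if j = l then 0 else c • (y j ^ k 0 * a l), fun I hI => ?_⟩
    have := ha (fun t => I t.succ) (fun t => by simpa using hI t.succ)
    rw [List.ofFn_succ, List.prod_cons, mul_assoc, this, pw _ _ (hk 0), Finset.sum_mul_sum]
    refine Finset.sum_congr rfl fun j _ => ?_
    rw [TensorProduct.sum_tmul]
    refine Finset.sum_congr rfl fun l _ => ?_
    have h0 : I 0 ≠ I (Fin.succ 0) := by simpa using hI 0
    rw [Algebra.TensorProduct.tmul_mul_tmul]
    split_ifs with h
    · subst h
      rw [← mul_assoc (v j _), hr _ _ _ h0]; simp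
    · rw [hP _ _ _ _ h h0, TensorProduct.tmul_smul, TensorProduct.smul_tmul']

theorem aux_W {A C : Type*} [Ring A] [Algebra ℂ A] [Ring C] [Algebra ℂ C] {N : ℕ}
    (φ : A →ₗ[ℂ] ℂ) (x : Fin N → A) (X : Fin N → A ⊗[ℂ] C) (P : C) (ψ : A ⊗[ℂ] C →ₗ[ℂ] C)
    (h : ∀ (m : ℕ) (i : Fin (m + 1) → Fin N), φ ((List.ofFn fun t => x (i t)).prod) • P =
      ψ ((List.ofFn fun t => X (i t)).prod))
    (z : A × (A ⊗[ℂ] C))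
    (hz : z ∈ NonUnitalAlgebra.adjoin ℂ (Set.range fun t => (x t, X t))) :
    φ z.1 • P = ψ z.2 := by
  rw [← NonUnitalSubalgebra.mem_toSubmodule, NonUnitalAlgebra.adjoin_eq_span] at hz
  induction hz using Submodule.span_induction with
  | zero => simp
  | add a b _ _ ha hb => simp [add_smul, ha, hb]
  | smul c a _ ha => simp [← ha, mul_smul]
  | mem z hz =>
    have : ∃ (m : ℕ) (i : Fin (m + 1) → Fin N), z = (List.ofFn fun t => (x (i t), X (i t))).prod := by
      induction hz using Subsemigroup.closure_induction with
      | mem z hz =>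
        obtain ⟨t, rfl⟩ := hz
        exact ⟨0, fun _ => t, by simp⟩
      | mul a b _ _ ha hb =>
        obtain ⟨m, i, rfl⟩ := ha
        obtain ⟨m', i', rfl⟩ := hb
        refine ⟨m + 1 + m', (show Fin (m + 1 + (m' + 1)) → Fin N from Fin.append i i'), ?_⟩
        rw [← List.prod_append]
        have e := List.ofFn_fin_append i i'
        have e1 := congrArg (List.map (fun t => (x t, X t))) e
        rw [List.map_append, List.map_ofFn, List.map_ofFn, List.map_ofFn] at e1
        exact congrArg List.prod e1.symm
    obtain ⟨m, i, rfl⟩ := this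
    have e1 : (List.ofFn fun t => (x (i t), X (i t))).prod.1 = (List.ofFn fun t => x (i t)).prod := by
      have := map_list_prod (RingHom.fst A (A ⊗[ℂ] C)) (List.ofFn fun t => (x (i t), X (i t)))
      rw [List.map_ofFn] at this
      exact this
    have e2 : (List.ofFn fun t => (x (i t), X (i t))).prod.2 = (List.ofFn fun t => X (i t)).prod := by
      have := map_list_prod (RingHom.snd A (A ⊗[ℂ] C)) (List.ofFn fun t => (x (i t), X (i t)))
      rw [List.map_ofFn] at this
      exact this
    rw [e1, e2, h]

theorem aux_mem {R : Type*} [Ring R] [Algebra ℂ R] (S : NonUnitalSubalgebra ℂ R) (r : R)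
    (hr : r ∈ S) (k : ℕ) (hk : 1 ≤ k) : r ^ k ∈ S := by
  induction k, hk using Nat.le_induction with
  | base => simpa
  | succ k _ ih => rw [pow_succ]; exact S.mul_mem ih hr

theorem aux_mem_prod {R : Type*} [Ring R] [Algebra ℂ R] (S : NonUnitalSubalgebra ℂ R) (m : ℕ)
    (f : Fin (m + 1) → R) (hf : ∀ t, f t ∈ S) : (List.ofFn f).prod ∈ S := by
  induction m with
  | zero => simpa using hf 0
  | succ m ih =>
    rw [List.ofFn_succ, List.prod_cons]
    exact S.mul_mem (hf _) (ih _ fun t => hf _)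

/-- Let `φ` be a state on a unital C*-algebra `A` and `(x_i)` a sequence of selfadjoint
elements (here `x t` stands for `x_{t+1}`) whose joint distributions are invariant under the
linear coactions of the `𝓑_s(n)`.  If `a, b` lie in the (non-unital) subalgebra generated by
`x_1,…,x_M` and the index tuples `i, j` have all entries `> M` (0-indexed: `≥ M`) and
consecutive entries distinct, then
`φ(a·x_{i₀}^{k₀}⋯x_{i_m}^{k_m}·b) = φ(a·x_{j₀}^{k₀}⋯x_{j_m}^{k_m}·b)`. -/
theorem stmt12 {A : Type u} [NormedRing A] [StarRing A] [CStarRing A] [NormedAlgebra ℂ A]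
    [CompleteSpace A]
    (φ : A →ₗ[ℂ] ℂ) (hpos : ∀ a : A, 0 ≤ φ (star a * a)) (hone : φ 1 = 1)
    (x : ℕ → A) (hsa : ∀ i, star (x i) = x i)
    (hinv : ∀ n : ℕ, BsLinInvariant.{u} φ fun t : Fin n => x t)
    (M : ℕ) (hM : 1 ≤ M) (a b : A)
    (ha : a ∈ NonUnitalAlgebra.adjoin ℂ (Set.range fun t : Fin M => x t))
    (hb : b ∈ NonUnitalAlgebra.adjoin ℂ (Set.range fun t : Fin M => x t))
    (m : ℕ) (k : Fin (m + 1) → ℕ) (hk : ∀ t, 1 ≤ k t)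
    (i j : Fin (m + 1) → ℕ)
    (hiM : ∀ t, M ≤ i t) (hjM : ∀ t, M ≤ j t)
    (hnei : ∀ t : Fin m, i t.castSucc ≠ i t.succ)
    (hnej : ∀ t : Fin m, j t.castSucc ≠ j t.succ) :
    φ (a * (List.ofFn fun t => x (i t) ^ k t).prod * b) =
      φ (a * (List.ofFn fun t => x (j t) ^ k t).prod * b) := by
  obtain ⟨n, hn, hin, hjn⟩ : ∃ n, 2 ≤ n ∧ (∀ t, i t < M + n) ∧ (∀ t, j t < M + n) := by
    refine ⟨2 + ∑ t, i t + ∑ t, j t, by omega, fun t => ?_, fun t => ?_⟩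
    · have := Finset.single_le_sum (f := i) (fun _ _ => Nat.zero_le _) (Finset.mem_univ t)
      omega
    · have := Finset.single_le_sum (f := j) (fun _ _ => Nat.zero_le _) (Finset.mem_univ t)
      omega
  obtain ⟨C, _, _, _, _, _, v, P, hrel, hP0, hv4, hv5⟩ := aux_rep.{u} n hn
  obtain ⟨w, hw, w1, w2, w3, w4⟩ := aux_pad M v P hrel
  obtain ⟨r1, r2, r3, r4, r5, r6, r7⟩ := hrel
  let y : Fin n → A := fun t => x (M + t)
  obtain ⟨α, hα⟩ := aux_chain y v P _ r2 r3 r4 hv4 m k hk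
  let ψ : A ⊗[ℂ] C →ₗ[ℂ] C := TensorProduct.lift
    ((LinearMap.lsmul ℂ (C →ₗ[ℂ] C)).flip
      (LinearMap.mulLeft ℂ P ∘ₗ LinearMap.mulRight ℂ P) ∘ₗ φ)
  have hψ : ∀ a c, ψ (a ⊗ₜ c) = φ a • (P * c * P) := by
    intro a c
    simp [ψ, mul_assoc]
  have hψP : ∀ Z, ψ (Z * (1 ⊗ₜ P)) = ψ Z := by
    intro Z
    induction Z using TensorProduct.induction_on with
    | zero => simp
    | add a b ha hb => rw [add_mul, map_add, map_add, ha, hb]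
    | tmul a c =>
      rw [Algebra.TensorProduct.tmul_mul_tmul, hψ, hψ, mul_one, mul_assoc P (c * P) P,
        mul_assoc c P P, r6, mul_assoc]
  let X : Fin (M + n) → A ⊗[ℂ] C := fun i => ∑ l : Fin (M + n), x l ⊗ₜ[ℂ] w l i
  have hX : ∀ (m : ℕ) (i : Fin (m + 1) → Fin (M + n)),
      φ ((List.ofFn fun t => x (i t)).prod) • P = ψ ((List.ofFn fun t => X (i t)).prod) := by
    intro m i
    rw [hinv (M + n) C w P hw m i, aux_expand, map_sum]
    refine Finset.sum_congr rfl fun J _ => ?_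
    rw [aux_tmul, hψ]
  have hW := aux_W φ (fun t : Fin (M + n) => x t) X P ψ hX
  set W := NonUnitalAlgebra.adjoin ℂ (Set.range fun t : Fin (M + n) => (x t, X t)) with hWdef
  have hXW : ∀ t : Fin (M + n), (x t, X t) ∈ W := fun t =>
    NonUnitalAlgebra.subset_adjoin ℂ ⟨t, rfl⟩
  have hX1 : ∀ t : Fin M, X (Fin.castAdd n t) = x t ⊗ₜ 1 := by
    intro t
    simp only [X, Fin.sum_univ_add, w1, w3]
    rw [Finset.sum_eq_single t]
    · simp
    · intro b _ hb; simp [hb]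
    · simp
  have hX2 : ∀ t : Fin n, X (Fin.natAdd M t) = ∑ l, y l ⊗ₜ v l t := by
    intro t
    simp [X, Fin.sum_univ_add, w2, w4, y]
  have hAW : ∀ a ∈ NonUnitalAlgebra.adjoin ℂ (Set.range fun t : Fin M => x t),
      (a, a ⊗ₜ[ℂ] (1 : C)) ∈ W := by
    intro a ha
    induction ha using NonUnitalAlgebra.adjoin_induction with
    | mem z hz =>
      obtain ⟨t, rfl⟩ := hz
      have := hXW (Fin.castAdd n t)
      rw [hX1] at this
      exact this
    | zero => rw [TensorProduct.zero_tmul]; exact W.zero_mem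
    | add a b _ _ ha hb =>
      have := W.add_mem ha hb
      rwa [Prod.mk_add_mk, ← TensorProduct.add_tmul] at this
    | smul c a _ ha =>
      have := W.smul_mem c ha
      rwa [Prod.smul_mk, TensorProduct.smul_tmul'] at this
    | mul a b _ _ ha hb =>
      have := W.mul_mem ha hb
      rwa [Prod.mk_mul_mk, Algebra.TensorProduct.tmul_mul_tmul, one_mul] at this
  have main : ∀ i : Fin (m + 1) → ℕ, (∀ t, M ≤ i t) → (∀ t, i t < M + n) →
      (∀ t : Fin m, i t.castSucc ≠ i t.succ) →
      φ (a * (List.ofFn fun t => x (i t) ^ k t).prod * b) • P =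
        ∑ l, φ (a * α l * b) • ((n : ℂ)⁻¹ • P) := by
    intro i hiM hin hnei
    obtain ⟨I, hI⟩ : ∃ I : Fin (m + 1) → Fin n, ∀ t, i t = M + I t :=
      ⟨fun t => ⟨i t - M, by have := hiM t; have := hin t; omega⟩,
        fun t => by have := hiM t; simp; omega⟩
    have hII : ∀ t : Fin m, I t.castSucc ≠ I t.succ := by
      intro t h
      apply hnei t
      rw [hI, hI, h]
    have hmem := W.mul_mem (W.mul_mem (hAW a ha) (aux_mem_prod W m
      (fun t => (x (Fin.natAdd M (I t)), X (Fin.natAdd M (I t))) ^ k t)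
      (fun t => aux_mem W _ (hXW _) _ (hk t)))) (hAW b hb)
    have e1 := map_list_prod (RingHom.fst A (A ⊗[ℂ] C))
      (List.ofFn fun t => (x (Fin.natAdd M (I t)), X (Fin.natAdd M (I t))) ^ k t)
    have e2 := map_list_prod (RingHom.snd A (A ⊗[ℂ] C))
      (List.ofFn fun t => (x (Fin.natAdd M (I t)), X (Fin.natAdd M (I t))) ^ k t)
    rw [List.map_ofFn] at e1 e2
    have key := hW _ hmem
    simp only [Prod.fst_mul, Prod.snd_mul] at key
    simp only [RingHom.coe_fst, RingHom.coe_snd] at e1 e2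
    rw [e1, e2] at key
    have f1 : (List.ofFn fun t => x (i t) ^ k t) = List.ofFn (Prod.fst ∘ fun t =>
        (x (Fin.natAdd M (I t)), X (Fin.natAdd M (I t))) ^ k t) := by
      congr 1; funext t; simp [hI]
    have f2 : (List.ofFn fun t => (∑ l, y l ⊗ₜ[ℂ] v l (I t)) ^ k t) =
        List.ofFn (Prod.snd ∘ fun t =>
        (x (Fin.natAdd M (I t)), X (Fin.natAdd M (I t))) ^ k t) := by
      congr 1; funext t; simp [hX2]
    rw [← f1, ← f2] at key
    rw [key, ← hψP, mul_assoc, Algebra.TensorProduct.tmul_mul_tmul, mul_one, one_mul,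
      show b ⊗ₜ[ℂ] P = (1 ⊗ₜ[ℂ] P) * (b ⊗ₜ[ℂ] (1 : C)) by simp, ← mul_assoc,
      mul_assoc (a ⊗ₜ[ℂ] (1 : C)), hα I hII, Finset.mul_sum, Finset.sum_mul, map_sum]
    refine Finset.sum_congr rfl fun l _ => ?_
    rw [Algebra.TensorProduct.tmul_mul_tmul, Algebra.TensorProduct.tmul_mul_tmul, hψ, one_mul,
      mul_one, hv5, smul_mul_assoc, r6]
  have h := (main i hiM hin hnei).trans (main j hjM hjn hnej).symm
  exact smul_left_injective ℂ hP0 h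
end
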